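/- The function f(x) = 1 + (ln 2)·2^{1/x}/x − 2^{1/x}, viewed as a map from (0,∞) to (0,∞), is a strictly decreasing continuous bijection of (0,∞) onto (0,∞); in particular it possesses an inverse function Λ : (0,∞) → (0,∞) satisfying Λ(f(x)) = x for all x > 0. -/

import Mathlib

/-- `f(x) = 1 + (ln 2)·2^{1/x}/x - 2^{1/x}` (equal to `-Θ'(x)` for `Θ(x) = x(2^{1/x}-1)`). -/
noncomputable def fTheta : ℝ → ℝ :=
  fun x => 1 + Real.log 2 * (2:ℝ) ^ (1/x) / x - (2:ℝ) ^ (1/x)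

noncomputable def gAux (u : ℝ) : ℝ := 1 + (u - 1) * Real.exp u

lemma fTheta_eq (x : ℝ) : fTheta x = gAux (Real.log 2 / x) := by
  have h : (2:ℝ) ^ (1/x) = Real.exp (Real.log 2 / x) := by
    rw [Real.rpow_def_of_pos (by norm_num)]
    congr 1
    ring
  unfold fTheta gAux
  simp only [h]
  ring

lemma gAux_cont : Continuous gAux := by
  unfold gAux
  fun_prop

lemma gAux_mono : StrictMonoOn gAux (Set.Ici 0) := by
  apply strictMonoOn_of_deriv_pos (convex_Ici 0) gAux_cont.continuousOn
  intro x hx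
  rw [interior_Ici] at hx
  have hx' : 0 < x := hx
  have h : HasDerivAt gAux (1 * Real.exp x + (x - 1) * Real.exp x) x :=
    (((hasDerivAt_id x).sub_const 1).mul (Real.hasDerivAt_exp x)).const_add 1
  rw [h.deriv]
  have := mul_pos hx' (Real.exp_pos x)
  linarith

lemma gAux_zero : gAux 0 = 0 := by simp [gAux]

lemma gAux_surj (y : ℝ) (hy : 0 < y) : ∃ u, 0 < u ∧ gAux u = y := by
  have h1 : y ≤ gAux (1 + y) := by
    unfold gAux
    have := Real.one_le_exp (x := 1 + y) (by linarith)
    nlinarith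
  obtain ⟨u, hu, rfl⟩ := intermediate_value_Icc (by linarith : (0:ℝ) ≤ 1 + y)
    gAux_cont.continuousOn ⟨by rw [gAux_zero]; exact hy.le, h1⟩
  refine ⟨u, lt_of_le_of_ne hu.1 ?_, rfl⟩
  rintro rfl
  rw [gAux_zero] at hy
  exact lt_irrefl _ hy

/-- Viewed as a map from `(0,∞)` to `(0,∞)`, `f` is a strictly decreasing continuous
bijection of `(0,∞)` onto `(0,∞)`; in particular it has an inverse function
`Λ : (0,∞) → (0,∞)` with `Λ(f(x)) = x` for all `x > 0`. -/
theorem stmt_9 :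
    (∀ x : ℝ, 0 < x → 0 < fTheta x) ∧
    StrictAntiOn fTheta (Set.Ioi (0:ℝ)) ∧
    ContinuousOn fTheta (Set.Ioi (0:ℝ)) ∧
    Set.BijOn fTheta (Set.Ioi (0:ℝ)) (Set.Ioi (0:ℝ)) ∧
    ∃ Lam : ℝ → ℝ,
      (∀ y : ℝ, 0 < y → 0 < Lam y) ∧
      (∀ x : ℝ, 0 < x → Lam (fTheta x) = x) ∧
      (∀ y : ℝ, 0 < y → fTheta (Lam y) = y) := by
  have hl : 0 < Real.log 2 := Real.log_pos (by norm_num)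
  have hpos : ∀ x : ℝ, 0 < x → 0 < fTheta x := by
    intro x hx
    have hd := div_pos hl hx
    have := gAux_mono (Set.mem_Ici.2 le_rfl) (Set.mem_Ici.2 hd.le) hd
    rwa [gAux_zero, ← fTheta_eq] at this
  have hanti : StrictAntiOn fTheta (Set.Ioi (0:ℝ)) := by
    intro x hx y hy hxy
    have hx' : 0 < x := hx
    have hy' : 0 < y := hy
    rw [fTheta_eq, fTheta_eq]
    exact gAux_mono (Set.mem_Ici.2 (div_pos hl hy').le) (Set.mem_Ici.2 (div_pos hl hx').le)
      (div_lt_div_of_pos_left hl hx' hxy)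
  have hcont : ContinuousOn fTheta (Set.Ioi (0:ℝ)) := by
    have he : fTheta = fun x => gAux (Real.log 2 / x) := funext fTheta_eq
    rw [he]
    apply gAux_cont.comp_continuousOn
    exact continuousOn_const.div continuousOn_id (fun x hx => ne_of_gt hx)
  have hsurj : Set.SurjOn fTheta (Set.Ioi (0:ℝ)) (Set.Ioi (0:ℝ)) := by
    intro y hy
    obtain ⟨u, hu, h⟩ := gAux_surj y hy
    refine ⟨Real.log 2 / u, div_pos hl hu, ?_⟩
    rw [fTheta_eq, div_div_cancel₀ hl.ne', h]
  have hb : Set.BijOn fTheta (Set.Ioi (0:ℝ)) (Set.Ioi (0:ℝ)) :=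
    ⟨fun x hx => hpos x hx, hanti.injOn, hsurj⟩
  have hinv := hb.invOn_invFunOn
  exact ⟨hpos, hanti, hcont, hb, Function.invFunOn fTheta (Set.Ioi 0),
    fun y hy => hsurj.mapsTo_invFunOn hy, fun x hx => hinv.1 hx, fun y hy => hinv.2 hy⟩
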